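/- Let m be a positive integer and a an integer with a > m. Then ∑_{k=1}^{m} ψ₀(k)·ψ₀(a+1-k)/(m+1-k) = (1/2)·∑_{k=1}^{m} ( ψ₀²(a+1-k)/k - ψ₀²(k)/(k+a-m) + ψ₁(k+a-m)/k - ψ₁(k)/(k+a-m) ) - (1/(a-m) - ψ₀(a+1))·∑_{k=1}^{m} ψ₀(k+a-m)/k + (1/(2(a-m)²))·( 3·(ψ₀(a+1) - ψ₀(a-m+1) - ψ₀(m+1) + ψ₀(1)) ) - (1/(2(a-m)))·( ψ₀²(a+1) + 2·(ψ₀(1) - 2ψ₀(m+1))·ψ₀(a+1) - ψ₀²(a-m+1) + 2ψ₀(1)·ψ₀(a-m+1) + 2·(ψ₀(m+1) - ψ₀(1))·ψ₀(m+1) + 2ψ₁(m+1) - 2ψ₁(1) ) + (1/12)·( 6ψ₀(a-m+1)·( (-ψ₀(a+1) + ψ₀(m+1) - 2ψ₀(1))·(ψ₀(m+1) - ψ₀(a+1)) + ψ₁(m+1) - 2ψ₁(1) ) - 4ψ₀³(a+1) + 6ψ₀(1)·ψ₀²(a+1) + 6ψ₀²(m+1)·ψ₀(a+1) + 6ψ₁(a-m+1)·ψ₀(a+1)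 - 6ψ₀(m+1)·(ψ₀²(a+1) + ψ₁(a-m+1)) + 6ψ₁(m+1)·ψ₀(a+1) - 6ψ₀(a+1)·ψ₁(a+1) - ψ₂(a+1) - 2ψ₀³(a-m+1) + 6ψ₀(1)·ψ₁(a-m+1) + ψ₂(a-m+1) ). -/

import Mathlib

open Finset

/-- Digamma function at a positive integer argument: `ψ₀ l = -γ + ∑_{i=1}^{l-1} 1/i`. -/
noncomputable def ψ₀ (l : ℕ) : ℝ :=
  -Real.eulerMascheroniConstant + ∑ i ∈ Finset.range (l - 1), (1 : ℝ) / (i + 1)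

/-- Trigamma function at a positive integer argument: `ψ₁ l = π²/6 - ∑_{i=1}^{l-1} 1/i²`. -/
noncomputable def ψ₁ (l : ℕ) : ℝ :=
  Real.pi ^ 2 / 6 - ∑ i ∈ Finset.range (l - 1), (1 : ℝ) / (i + 1) ^ 2

/-- Tetragamma function at a positive integer argument:
`ψ₂ l = -2ζ(3) + 2∑_{i=1}^{l-1} 1/i³`, where `ζ(3) = ∑_{i=1}^∞ 1/i³`. -/
noncomputable def ψ₂ (l : ℕ) : ℝ :=
  -2 * (∑' i : ℕ, (1 : ℝ) / (i + 1) ^ 3) +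
    2 * ∑ i ∈ Finset.range (l - 1), (1 : ℝ) / (i + 1) ^ 3

theorem psi0_succ (l : ℕ) : ψ₀ (l + 2) = ψ₀ (l + 1) + 1 / ((l : ℝ) + 1) := by
  simp [ψ₀, Finset.sum_range_succ]; ring

theorem psi1_succ (l : ℕ) : ψ₁ (l + 2) = ψ₁ (l + 1) - 1 / ((l : ℝ) + 1) ^ 2 := by
  simp [ψ₁, Finset.sum_range_succ]; ring

theorem psi2_succ (l : ℕ) : ψ₂ (l + 2) = ψ₂ (l + 1) + 2 / ((l : ℝ) + 1) ^ 3 := by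
  simp [ψ₂, Finset.sum_range_succ]; ring

/-- `hh l = ψ₀ (l+1)`. -/
noncomputable def hh (l : ℕ) : ℝ := ψ₀ (l + 1)
/-- `hi l = ψ₁ (l+1)`. -/
noncomputable def hi (l : ℕ) : ℝ := ψ₁ (l + 1)
/-- `hj l = ψ₂ (l+1)`. -/
noncomputable def hj (l : ℕ) : ℝ := ψ₂ (l + 1)

theorem hh_succ (l : ℕ) : hh (l + 1) = hh l + 1 / ((l : ℝ) + 1) := psi0_succ l
theorem hi_succ (l : ℕ) : hi (l + 1) = hi l - 1 / ((l : ℝ) + 1) ^ 2 := psi1_succ l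
theorem hj_succ (l : ℕ) : hj (l + 1) = hj l + 2 / ((l : ℝ) + 1) ^ 3 := psi2_succ l

theorem sum_inv (m : ℕ) : ∑ i ∈ range m, 1 / ((i : ℝ) + 1) = hh m - hh 0 := by
  induction m with
  | zero => simp
  | succ m ih => rw [sum_range_succ, ih, hh_succ]; ring

/-- Reversal of the range `n, …, n+m-1` (with `n = d+1` entering as `d`). -/
theorem sum_rev (f : ℕ → ℝ) (m n : ℕ) :
    ∑ i ∈ range m, f (m + n - 1 - i) = ∑ i ∈ range m, f (n + i) := by
  rw [← sum_range_reflect]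
  apply sum_congr rfl
  intro i hi
  rw [mem_range] at hi
  congr 1
  omega

theorem sum_inv_shift (m n : ℕ) :
    ∑ i ∈ range m, 1 / (((n + i : ℕ) : ℝ) + 1) = hh (m + n) - hh n := by
  induction m with
  | zero => simp
  | succ m ih =>
    rw [sum_range_succ, ih, show m + 1 + n = (m + n) + 1 by ring, hh_succ]
    push_cast; ring

theorem sum_inv_sq_shift (m n : ℕ) :
    ∑ i ∈ range m, 1 / (((n + i : ℕ) : ℝ) + 1) ^ 2 = hi n - hi (m + n) := by
  induction m with
  | zero => simp
  | succ m ih =>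
    rw [sum_range_succ, ih, show m + 1 + n = (m + n) + 1 by ring, hi_succ]
    push_cast; ring

theorem sum_h_shift (m n : ℕ) :
    ∑ i ∈ range m, hh (n + i) / (((n + i : ℕ) : ℝ) + 1) =
      (hh (m + n) ^ 2 - hh n ^ 2 - (hi n - hi (m + n))) / 2 := by
  induction m with
  | zero => simp
  | succ m ih =>
    rw [sum_range_succ, ih, show m + 1 + n = (m + n) + 1 by ring, hi_succ, hh_succ,
      show n + m = m + n by ring]
    push_cast; field_simp; ring

theorem pf1 (m n i : ℕ) (h : i < m) (hn : 0 < n) :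
    1 / ((((m + n - 1 - i : ℕ) : ℝ) + 1) * ((i : ℝ) + 1)) =
      1 / ((m : ℝ) + n + 1) * (1 / ((i : ℝ) + 1) + 1 / (((m + n - 1 - i : ℕ) : ℝ) + 1)) := by
  obtain ⟨j, hj⟩ : ∃ j, m + n = j + 1 + i := ⟨m + n - 1 - i, by omega⟩
  have e : m + n - 1 - i = j := by omega
  rw [e]
  have : (m : ℝ) + n = j + 1 + i := by exact_mod_cast hj
  rw [this]
  field_simp; ring

theorem sum_B (m n : ℕ) (hn : 0 < n) :
    ∑ i ∈ range m, 1 / ((((m + n - 1 - i : ℕ) : ℝ) + 1) * ((i : ℝ) + 1)) =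
      1 / ((m : ℝ) + n + 1) * (hh m - hh 0 + hh (m + n) - hh n) := by
  rw [sum_congr rfl fun i hi => pf1 m n i (mem_range.1 hi) hn, ← mul_sum, sum_add_distrib,
    sum_inv, sum_rev (fun l => 1 / ((l : ℝ) + 1)) m n, sum_inv_shift]
  ring

/-- The sum `∑ ψ₀(k+n)/k`. -/
noncomputable def S5 (m n : ℕ) : ℝ := ∑ i ∈ range m, hh (n + i) / ((i : ℝ) + 1)
/-- The sum `∑ ψ₀(m+n+1-k)/k`. -/
noncomputable def S6 (m n : ℕ) : ℝ := ∑ i ∈ range m, hh (m + n - 1 - i) / ((i : ℝ) + 1)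

theorem S6_succ (m n : ℕ) (hn : 0 < n) :
    S6 (m + 1) n = S6 m n + hh n / ((m : ℝ) + 1) +
      1 / ((m : ℝ) + n + 1) * (hh m - hh 0 + hh (m + n) - hh n) := by
  rw [← sum_B m n hn, S6, S6, sum_range_succ, show m + 1 + n - 1 - m = n by omega]
  have : ∀ i ∈ range m, hh (m + 1 + n - 1 - i) / ((i : ℝ) + 1) =
      hh (m + n - 1 - i) / ((i : ℝ) + 1) +
        1 / ((((m + n - 1 - i : ℕ) : ℝ) + 1) * ((i : ℝ) + 1)) := by
    intro i hi
    rw [mem_range] at hi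
    rw [show m + 1 + n - 1 - i = (m + n - 1 - i) + 1 by omega, hh_succ]
    field_simp
  rw [sum_congr rfl this, sum_add_distrib]
  ring

theorem S5_succ (m n : ℕ) :
    S5 (m + 1) n = S5 m n + hh (m + n) / ((m : ℝ) + 1) := by
  rw [S5, S5, sum_range_succ, add_comm n m]

theorem S56 (m n : ℕ) (hn : 0 < n) :
    S5 m n + S6 m n = (hh m - hh 0) * (hh (m + n) + hh n) +
      (hh (m + n) ^ 2 + hi (m + n) - hh n ^ 2 - hi n) / 2 - hh n * (hh (m + n) - hh n)
      - (hh m - hh 0 - hh (m + n) + hh n) / n := by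
  have hn' : (n : ℝ) ≠ 0 := by positivity
  induction m with
  | zero => simp [S5, S6]
  | succ m ih =>
    have e : S6 m n = ((hh m - hh 0) * (hh (m + n) + hh n) +
      (hh (m + n) ^ 2 + hi (m + n) - hh n ^ 2 - hi n) / 2 - hh n * (hh (m + n) - hh n)
      - (hh m - hh 0 - hh (m + n) + hh n) / n) - S5 m n := by rw [← ih]; ring
    rw [S5_succ, S6_succ m n hn, e, show m + 1 + n = (m + n) + 1 by ring, hh_succ, hh_succ, hi_succ]
    push_cast
    field_simp
    ring

/-- The sum `∑ ψ₀(m+n+1-k)²/k`. -/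
noncomputable def S1 (m n : ℕ) : ℝ := ∑ i ∈ range m, hh (m + n - 1 - i) ^ 2 / ((i : ℝ) + 1)

theorem S1_succ (m n : ℕ) (hn : 0 < n) :
    S1 (m + 1) n = S1 m n + hh n ^ 2 / ((m : ℝ) + 1) +
      2 / ((m : ℝ) + n + 1) *
        (S6 m n + (hh (m + n) ^ 2 - hh n ^ 2 - (hi n - hi (m + n))) / 2) +
      1 / ((m : ℝ) + n + 1) * (1 / ((m : ℝ) + n + 1) * (hh m - hh 0 + hh (m + n) - hh n)
        + (hi n - hi (m + n))) := by
  rw [S1, S1, sum_range_succ, show m + 1 + n - 1 - m = n by omega]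
  have : ∀ i ∈ range m, hh (m + 1 + n - 1 - i) ^ 2 / ((i : ℝ) + 1) =
      hh (m + n - 1 - i) ^ 2 / ((i : ℝ) + 1) +
      (2 / ((m : ℝ) + n + 1) * (hh (m + n - 1 - i) / ((i : ℝ) + 1) +
        hh (m + n - 1 - i) / (((m + n - 1 - i : ℕ) : ℝ) + 1)) +
      1 / ((m : ℝ) + n + 1) * (1 / ((((m + n - 1 - i : ℕ) : ℝ) + 1) * ((i : ℝ) + 1)) +
        1 / (((m + n - 1 - i : ℕ) : ℝ) + 1) ^ 2)) := by
    intro i hi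
    rw [mem_range] at hi
    obtain ⟨j, hj⟩ : ∃ j, m + n = j + 1 + i := ⟨m + n - 1 - i, by omega⟩
    rw [show m + 1 + n - 1 - i = j + 1 by omega, show m + n - 1 - i = j by omega, hh_succ]
    have : (m : ℝ) + n = j + 1 + i := by exact_mod_cast hj
    rw [this]
    field_simp
    ring
  rw [sum_congr rfl this, sum_add_distrib, sum_add_distrib, ← mul_sum, ← mul_sum,
    sum_add_distrib, sum_add_distrib, sum_B m n hn,
    sum_rev (fun l => 1 / ((l : ℝ) + 1) ^ 2) m n,
    sum_rev (fun l => hh l / ((l : ℝ) + 1)) m n, sum_inv_sq_shift, sum_h_shift, S6]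
  ring

/-- The left-hand side, reindexed. -/
noncomputable def LL (m n : ℕ) : ℝ :=
  ∑ i ∈ range m, hh (m - 1 - i) * hh (n + i) / ((i : ℝ) + 1)

theorem LL_succ (m n : ℕ) :
    LL (m + 1) n = LL m n + hh 0 * hh (m + n) / ((m : ℝ) + 1) +
      1 / ((m : ℝ) + 1) * (S5 m n + S6 m n) := by
  have h6 : S6 m n = ∑ i ∈ range m, hh (n + i) / (((m - 1 - i : ℕ) : ℝ) + 1) := by
    rw [S6, ← sum_range_reflect]
    apply sum_congr rfl
    intro i hi
    rw [mem_range] at hi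
    rw [show m + n - 1 - (m - 1 - i) = n + i by omega]
  rw [h6, S5, LL, LL, sum_range_succ, ← sum_add_distrib, mul_sum,
    show m + 1 - 1 - m = 0 by omega, add_comm n m, add_right_comm, ← sum_add_distrib]
  congr 1
  apply sum_congr rfl
  intro i hi
  rw [mem_range] at hi
  obtain ⟨j, rfl⟩ : ∃ j, m = j + 1 + i := ⟨m - 1 - i, by omega⟩
  rw [show j + 1 + i + 1 - 1 - i = j + 1 by omega, show j + 1 + i - 1 - i = j by omega, hh_succ]
  push_cast
  field_simp
  ring

theorem core (m n : ℕ) (hn : 0 < n) :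
    LL m n = 1 / 2 * (S1 m n + ∑ i ∈ range m, (- (hh i ^ 2 / ((i : ℝ) + 1 + n)) +
        hi (n + i) / ((i : ℝ) + 1) - hi i / ((i : ℝ) + 1 + n))) -
      (1 / (n : ℝ) - hh (m + n)) * S5 m n +
      (1 / (2 * (n : ℝ) ^ 2)) * (3 * (hh (m + n) - hh n - hh m + hh 0)) -
      (1 / (2 * (n : ℝ))) *
          (hh (m + n) ^ 2 + 2 * (hh 0 - 2 * hh m) * hh (m + n) -
            hh n ^ 2 + 2 * hh 0 * hh n +
            2 * (hh m - hh 0) * hh m + 2 * hi m - 2 * hi 0) +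
        (1 / 12) * (6 * hh n *
            ((-hh (m + n) + hh m - 2 * hh 0) * (hh m - hh (m + n)) +
              hi m - 2 * hi 0) -
          4 * hh (m + n) ^ 3 + 6 * hh 0 * hh (m + n) ^ 2 +
          6 * hh m ^ 2 * hh (m + n) + 6 * hi n * hh (m + n) -
          6 * hh m * (hh (m + n) ^ 2 + hi n) +
          6 * hi m * hh (m + n) - 6 * hh (m + n) * hi (m + n) - hj (m + n) -
          2 * hh n ^ 3 + 6 * hh 0 * hi n + hj n) := by
  have hn' : (n : ℝ) ≠ 0 := by positivity
  induction m with
  | zero => simp [LL, S1, S5]; ring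
  | succ m ih =>
    have e := S56 m n hn
    rw [LL_succ, ih, S1_succ m n hn, sum_range_succ, S5_succ, e,
      eq_sub_of_add_eq' e, show m + 1 + n = (m + n) + 1 by ring, hh_succ, hh_succ,
      hi_succ, hi_succ, hj_succ, add_comm n m]
    generalize ∑ i ∈ range m, (- (hh i ^ 2 / ((i : ℝ) + 1 + n)) +
        hi (m + n) / ((i : ℝ) + 1) - hi i / ((i : ℝ) + 1 + n)) = T
    push_cast
    rw [show (m : ℝ) + 1 + n = m + n + 1 by ring]
    field_simp
    ring

theorem stmt12 (m a : ℕ) (hm : 0 < m) (ha : m < a) :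
    ∑ k ∈ Finset.Icc 1 m, ψ₀ k * ψ₀ (a + 1 - k) / ((m + 1 - k : ℕ) : ℝ) =
      (1 / 2) * ∑ k ∈ Finset.Icc 1 m,
          (ψ₀ (a + 1 - k) ^ 2 / (k : ℝ) - ψ₀ k ^ 2 / ((k + a - m : ℕ) : ℝ) +
            ψ₁ (k + a - m) / (k : ℝ) - ψ₁ k / ((k + a - m : ℕ) : ℝ)) -
        (1 / ((a : ℝ) - m) - ψ₀ (a + 1)) *
          ∑ k ∈ Finset.Icc 1 m, ψ₀ (k + a - m) / (k : ℝ) +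
        (1 / (2 * ((a : ℝ) - m) ^ 2)) *
          (3 * (ψ₀ (a + 1) - ψ₀ (a - m + 1) - ψ₀ (m + 1) + ψ₀ 1)) -
        (1 / (2 * ((a : ℝ) - m))) *
          (ψ₀ (a + 1) ^ 2 + 2 * (ψ₀ 1 - 2 * ψ₀ (m + 1)) * ψ₀ (a + 1) -
            ψ₀ (a - m + 1) ^ 2 + 2 * ψ₀ 1 * ψ₀ (a - m + 1) +
            2 * (ψ₀ (m + 1) - ψ₀ 1) * ψ₀ (m + 1) + 2 * ψ₁ (m + 1) - 2 * ψ₁ 1) +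
        (1 / 12) * (6 * ψ₀ (a - m + 1) *
            ((-ψ₀ (a + 1) + ψ₀ (m + 1) - 2 * ψ₀ 1) * (ψ₀ (m + 1) - ψ₀ (a + 1)) +
              ψ₁ (m + 1) - 2 * ψ₁ 1) -
          4 * ψ₀ (a + 1) ^ 3 + 6 * ψ₀ 1 * ψ₀ (a + 1) ^ 2 +
          6 * ψ₀ (m + 1) ^ 2 * ψ₀ (a + 1) + 6 * ψ₁ (a - m + 1) * ψ₀ (a + 1) -
          6 * ψ₀ (m + 1) * (ψ₀ (a + 1) ^ 2 + ψ₁ (a - m + 1)) +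
          6 * ψ₁ (m + 1) * ψ₀ (a + 1) - 6 * ψ₀ (a + 1) * ψ₁ (a + 1) - ψ₂ (a + 1) -
          2 * ψ₀ (a - m + 1) ^ 3 + 6 * ψ₀ 1 * ψ₁ (a - m + 1) + ψ₂ (a - m + 1)) := by
  obtain ⟨n, rfl⟩ : ∃ n, a = m + n := ⟨a - m, by omega⟩
  have hn : 0 < n := by omega
  have key := core m n hn
  have c : (((m + n : ℕ) : ℝ) - m) = n := by push_cast; ring
  have tr : ∀ f : ℕ → ℝ, ∑ k ∈ Finset.Icc 1 m, f k = ∑ i ∈ range m, f (i + 1) := by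
    intro f
    rw [range_eq_Ico, sum_Ico_add' f 0 m 1]
    rfl
  have eL : ∑ k ∈ Finset.Icc 1 m, ψ₀ k * ψ₀ (m + n + 1 - k) / ((m + 1 - k : ℕ) : ℝ) = LL m n := by
    rw [tr, LL, ← sum_range_reflect]
    apply sum_congr rfl
    intro i hi
    rw [mem_range] at hi
    rw [hh, hh, show m - 1 - i + 1 = m - i by omega, show m + n + 1 - (m - i) = n + i + 1 by omega,
      show m + 1 - (m - i) = i + 1 by omega]
    push_cast
    rfl
  have e5 : ∑ k ∈ Finset.Icc 1 m, ψ₀ (k + (m + n) - m) / (k : ℝ) = S5 m n := by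
    rw [tr, S5]
    apply sum_congr rfl
    intro i hi
    rw [hh, show i + 1 + (m + n) - m = n + i + 1 by omega]
    push_cast
    rfl
  have e1 : ∑ k ∈ Finset.Icc 1 m,
          (ψ₀ (m + n + 1 - k) ^ 2 / (k : ℝ) - ψ₀ k ^ 2 / ((k + (m + n) - m : ℕ) : ℝ) +
            ψ₁ (k + (m + n) - m) / (k : ℝ) - ψ₁ k / ((k + (m + n) - m : ℕ) : ℝ)) =
      S1 m n + ∑ i ∈ range m, (- (hh i ^ 2 / ((i : ℝ) + 1 + n)) +
        hi (n + i) / ((i : ℝ) + 1) - hi i / ((i : ℝ) + 1 + n)) := by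
    rw [tr, S1, ← sum_add_distrib]
    apply sum_congr rfl
    intro i hi'
    rw [mem_range] at hi'
    rw [hh, hh, hi, hi, show i + 1 + (m + n) - m = n + i + 1 by omega,
      show m + n + 1 - (i + 1) = m + n - 1 - i + 1 by omega]
    push_cast
    rw [show (n : ℝ) + i + 1 = i + 1 + n by ring]
    ring
  rw [eL, e5, e1, c, key, show m + n - m = n by omega]
  rfl
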